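/- arXiv:math/0603432 — 4 statements merged into one kernel-verified Lean document; each statement's English description precedes it below -/
import Mathlib

section
/- Let ω = ω₀ + λΩ be a smooth closed differential 2-form on ℝ⁴ with ω₀ pointwise primitive and B = λ·Id − A₀. Then for every smooth function f on ℝ⁴ one has the identity d((df∘(B² + Id))∧Ω) = d(df∘B)∧ω; in particular the mixed form 𝕁df := df∘B + (df∘(B²+Id))∧Ω is closed if and only if d(df∘B) = 0, which is the pluriharmonicity characterization of generating functions. -/
noncomputable section

/-- `ℝ⁴` with coordinates `(q₁, q₂, p₁, p₂) = (x 0, x 1, x 2, x 3)`. -/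
abbrev V : Type := Fin 4 → ℝ

/-- The complexification `ℂ⁴`. -/
abbrev Vc : Type := Fin 4 → ℂ

/-- Standard basis of `ℝ⁴`: `e 0 = e_{q₁}`, `e 1 = e_{q₂}`, `e 2 = e_{p₁}`, `e 3 = e_{p₂}`. -/
def e (i : Fin 4) : V := Pi.single i 1

/-- Standard basis of `ℂ⁴`. -/
def ec (i : Fin 4) : Vc := Pi.single i 1

/-- The standard symplectic form `Ω = dq₁ ∧ dp₁ + dq₂ ∧ dp₂` on `ℝ⁴`. -/
def Omega : V → V → ℝ := fun x y => x 0 * y 2 - x 2 * y 0 + x 1 * y 3 - x 3 * y 1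

/-- The complex bilinear extension of `Ω` to `ℂ⁴`. -/
def OmegaC : Vc → Vc → ℂ := fun x y => x 0 * y 2 - x 2 * y 0 + x 1 * y 3 - x 3 * y 1

/-- Predicate: `ω` is an alternating (bilinear and antisymmetric) 2-form on `ℝ⁴`. -/
structure IsAlt2 (ω : V → V → ℝ) : Prop where
  add_left : ∀ x x' y, ω (x + x') y = ω x y + ω x' y
  smul_left : ∀ (c : ℝ) (x y : V), ω (c • x) y = c * ω x y
  antisymm : ∀ x y, ω x y = - ω y x

/-- Predicate: `θ` is a complex alternating (bilinear and antisymmetric) 2-form on `ℂ⁴`. -/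
structure IsAlt2C (θ : Vc → Vc → ℂ) : Prop where
  add_left : ∀ x x' y, θ (x + x') y = θ x y + θ x' y
  smul_left : ∀ (c : ℂ) (x y : Vc), θ (c • x) y = c * θ x y
  antisymm : ∀ x y, θ x y = - θ y x

section Wedge

variable {W : Type*} {k : Type*} [CommRing k]

/-- Wedge product of two 1-forms. -/
def wedge11 (a b : W → k) : W → W → k := fun x y => a x * b y - a y * b x

/-- Wedge product of a 1-form and a 2-form. -/
def wedge12 (a : W → k) (B : W → W → k) : W → W → W → k :=
  fun x y z => a x * B y z - a y * B x z + a z * B x y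

/-- Wedge product of a 1-form and a 3-form. -/
def wedge13 (a : W → k) (C : W → W → W → k) : W → W → W → W → k :=
  fun x y z w => a x * C y z w - a y * C x z w + a z * C x y w - a w * C x y z

/-- Wedge product of a 3-form and a 1-form. -/
def wedge31 (C : W → W → W → k) (a : W → k) : W → W → W → W → k :=
  fun x y z w => C x y z * a w - C x y w * a z + C x z w * a y - C y z w * a x

/-- Wedge product of two 2-forms. -/
def wedge22 (A B : W → W → k) : W → W → W → W → k :=
  fun x y z w =>
    A x y * B z w - A x z * B y w + A x w * B y z
      + A y z * B x w - A y w * B x z + A z w * B x y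

end Wedge

/-- `⊥` of a 2-form on `ℝ⁴`: contraction with the bivector dual to `Ω`. -/
def perpTwo (θ : V → V → ℝ) : ℝ := θ (e 0) (e 2) + θ (e 1) (e 3)

/-- `⊥` of a complex 2-form on `ℂ⁴`. -/
def perpTwoC (θ : Vc → Vc → ℂ) : ℂ := θ (ec 0) (ec 2) + θ (ec 1) (ec 3)

/-- `⊥` of a 3-form on `ℝ⁴`. -/
def perpThree (θ : V → V → V → ℝ) : V → ℝ := fun x => θ (e 0) (e 2) x + θ (e 1) (e 3) x

/-- A differential 1-form on `ℝ⁴` is smooth if its evaluation against any constant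
vector field is smooth. -/
def Smooth1 (α : V → V → ℝ) : Prop := ∀ x, ContDiff ℝ (⊤ : ℕ∞) fun p => α p x

/-- A differential 2-form on `ℝ⁴` is smooth if its evaluations against constant
vector fields are smooth. -/
def Smooth2 (ω : V → V → V → ℝ) : Prop := ∀ x y, ContDiff ℝ (⊤ : ℕ∞) fun p => ω p x y

/-- Exterior derivative of a differential 0-form (function), evaluated on a constant
vector field. -/
def d0 (f : V → ℝ) : V → V → ℝ := fun p x => fderiv ℝ f p x

/-- Exterior derivative of a differential 1-form, evaluated on constant vector fields. -/
def d1 (α : V → V → ℝ) : V → V → V → ℝ :=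
  fun p x y => fderiv ℝ (fun q => α q y) p x - fderiv ℝ (fun q => α q x) p y

/-- Exterior derivative of a differential 2-form, evaluated on constant vector fields. -/
def d2 (ω : V → V → V → ℝ) : V → V → V → V → ℝ :=
  fun p x y z =>
    fderiv ℝ (fun q => ω q y z) p x - fderiv ℝ (fun q => ω q x z) p y
      + fderiv ℝ (fun q => ω q x y) p z

/-- Exterior derivative of a differential 3-form, evaluated on constant vector fields. -/
def d3 (θ : V → V → V → V → ℝ) : V → V → V → V → V → ℝ :=
  fun p x y z w =>
    fderiv ℝ (fun q => θ q y z w) p x - fderiv ℝ (fun q => θ q x z w) p y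
      + fderiv ℝ (fun q => θ q x y w) p z - fderiv ℝ (fun q => θ q x y z) p w

/-- A mixed-degree complex form on `ℝ⁴`, given by its homogeneous components of
degree 0,1,2,3,4 (a degree-`k` component is recorded through its values on `k`-tuples
of complexified vectors). -/
structure Mixed where
  c0 : ℂ
  c1 : Vc → ℂ
  c2 : Vc → Vc → ℂ
  c3 : Vc → Vc → Vc → ℂ
  c4 : Vc → Vc → Vc → Vc → ℂ

namespace Mixed

instance : Zero Mixed := ⟨⟨0, 0, 0, 0, 0⟩⟩

instance : Add Mixed :=
  ⟨fun A B => ⟨A.c0 + B.c0, A.c1 + B.c1, A.c2 + B.c2, A.c3 + B.c3, A.c4 + B.c4⟩⟩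

instance : Neg Mixed := ⟨fun A => ⟨-A.c0, -A.c1, -A.c2, -A.c3, -A.c4⟩⟩

instance : SMul ℂ Mixed :=
  ⟨fun c A => ⟨c * A.c0, c • A.c1, c • A.c2, c • A.c3, c • A.c4⟩⟩

end Mixed

/-- A complex scalar, seen as a mixed form of degree 0. -/
def scalarM (c : ℂ) : Mixed := ⟨c, 0, 0, 0, 0⟩

/-- A complex 1-form, seen as a mixed form. -/
def oneM (α : Vc → ℂ) : Mixed := ⟨0, α, 0, 0, 0⟩

/-- A complex 2-form, seen as a mixed form. -/
def twoM (θ : Vc → Vc → ℂ) : Mixed := ⟨0, 0, θ, 0, 0⟩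

/-- Wedge product of mixed forms (degrees `> 4` vanish on `ℝ⁴`). -/
def wedgeM (A B : Mixed) : Mixed where
  c0 := A.c0 * B.c0
  c1 := fun x => A.c0 * B.c1 x + B.c0 * A.c1 x
  c2 := fun x y => A.c0 * B.c2 x y + B.c0 * A.c2 x y + wedge11 A.c1 B.c1 x y
  c3 := fun x y z => A.c0 * B.c3 x y z + B.c0 * A.c3 x y z
    + wedge12 A.c1 B.c2 x y z + wedge12 B.c1 A.c2 x y z
  c4 := fun x y z w => A.c0 * B.c4 x y z w + B.c0 * A.c4 x y z w
    + wedge13 A.c1 B.c3 x y z w + wedge31 A.c3 B.c1 x y z w + wedge22 A.c2 B.c2 x y z w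

/-- Interior product of a mixed form with a complexified vector `X`. -/
def iotaM (X : Vc) (A : Mixed) : Mixed :=
  ⟨A.c1 X, fun x => A.c2 X x, fun x y => A.c3 X x y, fun x y z => A.c4 X x y z, 0⟩

/-- The spin (Clifford) action `ρ(X + ξ)(θ) = ι_X θ + ξ ∧ θ` of `X + ξ ∈ (T ⊕ T*) ⊗ ℂ`
on mixed forms. -/
def rhoM (X : Vc) (ξ : Vc → ℂ) (A : Mixed) : Mixed := iotaM X A + wedgeM (oneM ξ) A

/-- Componentwise complex conjugation of a vector in `ℂ⁴`. -/
def cconj (x : Vc) : Vc := fun i => starRingEnd ℂ (x i)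

/-- Complex conjugation of a complex 2-form. -/
def conj2 (θ : Vc → Vc → ℂ) : Vc → Vc → ℂ :=
  fun x y => starRingEnd ℂ (θ (cconj x) (cconj y))

/-- Complex conjugation of a mixed form. -/
def conjM (A : Mixed) : Mixed where
  c0 := starRingEnd ℂ A.c0
  c1 := fun x => starRingEnd ℂ (A.c1 (cconj x))
  c2 := fun x y => starRingEnd ℂ (A.c2 (cconj x) (cconj y))
  c3 := fun x y z => starRingEnd ℂ (A.c3 (cconj x) (cconj y) (cconj z))
  c4 := fun x y z w => starRingEnd ℂ (A.c4 (cconj x) (cconj y) (cconj z) (cconj w))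

/-- Complex bilinear extension of a real 1-form on `ℝ⁴` to `ℂ⁴`. -/
def cx1 (α : V → ℝ) : Vc → ℂ := fun x => ∑ i, x i * (α (e i) : ℂ)

/-- Complex bilinear extension of a real 2-form on `ℝ⁴` to `ℂ⁴`. -/
def cx2 (ω : V → V → ℝ) : Vc → Vc → ℂ := fun x y => ∑ i, ∑ j, x i * y j * (ω (e i) (e j) : ℂ)

/-- `Θ = ω - iΩ`, as a complex 2-form on `ℂ⁴`. -/
def ThetaM (ω : V → V → ℝ) : Vc → Vc → ℂ :=
  fun x y => cx2 ω x y - Complex.I * OmegaC x y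

/-- `Φ = exp Θ = 1 + Θ + ½ Θ∧Θ`, as a mixed form. -/
def PhiM (ω : V → V → ℝ) : Mixed :=
  ⟨1, 0, ThetaM ω, 0, fun x y z w => (1 / 2 : ℂ) * wedge22 (ThetaM ω) (ThetaM ω) x y z w⟩

/-- Lie bracket of two vector fields on `ℝ⁴`. -/
def lieBracket (X Y : V → V) : V → V :=
  fun p => fderiv ℝ Y p (X p) - fderiv ℝ X p (Y p)

/-- The Nijenhuis tensor of a field `J` of endomorphisms of `ℝ⁴`, evaluated on two
vector fields: `N_J(X,Y) = [JX,JY] - J[JX,Y] - J[X,JY] + J²[X,Y]`. -/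
def nijenhuis (J : V → (V →ₗ[ℝ] V)) (X Y : V → V) : V → V :=
  fun p =>
    lieBracket (fun q => J q (X q)) (fun q => J q (Y q)) p
      - J p (lieBracket (fun q => J q (X q)) Y p)
      - J p (lieBracket X (fun q => J q (Y q)) p)
      + J p (J p (lieBracket X Y p))

theorem fderiv_wedge12_apply {β : V → V → ℝ} {ω : V → V → V → ℝ}
    (hβ : ∀ x, Differentiable ℝ fun p => β p x)
    (hω : ∀ x y, Differentiable ℝ fun p => ω p x y) (p x y z w : V) :
    fderiv ℝ (fun q => wedge12 (β q) (ω q) x y z) p w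
      = (fderiv ℝ (fun q => β q x) p w * ω p y z + β p x * fderiv ℝ (fun q => ω q y z) p w)
        - (fderiv ℝ (fun q => β q y) p w * ω p x z + β p y * fderiv ℝ (fun q => ω q x z) p w)
        + (fderiv ℝ (fun q => β q z) p w * ω p x y
          + β p z * fderiv ℝ (fun q => ω q x y) p w) := by
  have h (a b c : V) : HasFDerivAt (fun q => β q a * ω q b c) _ p :=
    (hβ a p).hasFDerivAt.mul (hω b c p).hasFDerivAt
  have hsum := ((h x y z).fun_sub (h y x z)).fun_add (h z x y)
  change fderiv ℝ (fun q => β q x * ω q y z - β q y * ω q x z + β q z * ω q x y) p w = _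
  rw [hsum.fderiv]
  simp only [add_apply, sub_apply, smul_apply, smul_eq_mul]
  ring

/-- The Leibniz rule `d(β ∧ ω) = dβ ∧ ω - β ∧ dω`. -/
theorem d3_wedge12 {β : V → V → ℝ} {ω : V → V → V → ℝ}
    (hβ : ∀ x, Differentiable ℝ fun p => β p x)
    (hω : ∀ x y, Differentiable ℝ fun p => ω p x y) (p x y z w : V) :
    d3 (fun q => wedge12 (β q) (ω q)) p x y z w
      = wedge22 (d1 β p) (ω p) x y z w - wedge13 (β p) (d2 ω p) x y z w := by
  simp only [d3, fderiv_wedge12_apply hβ hω, wedge22, wedge13, d1, d2]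
  ring

theorem d1_fderiv {f : V → ℝ} (hf : ContDiff ℝ 2 f) (p x y : V) :
    d1 (fun q v => fderiv ℝ f q v) p x y = 0 := by
  have hd : DifferentiableAt ℝ (fderiv ℝ f) p :=
    (hf.fderiv_right (m := 1) (by norm_num)).differentiable (by norm_num) p
  have h (a b : V) : fderiv ℝ (fun q => fderiv ℝ f q a) p b = fderiv ℝ (fderiv ℝ f) p b a := by
    rw [fderiv_clm_apply hd (differentiableAt_const a)]
    simp
  simp only [d1, h]
  have hsymm : IsSymmSndFDerivAt ℝ f p := hf.contDiffAt.isSymmSndFDerivAt (by simp)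
  rw [hsymm.eq x y, sub_self]

/-- Every linear form on `ℝ⁴` is the contraction of `Ω` with a vector. -/
theorem exists_Omega_eq (β : V →ₗ[ℝ] ℝ) : ∃ v, ∀ x, β x = Omega v x := by
  refine ⟨![β (e 2), β (e 3), -β (e 0), -β (e 1)], fun x => ?_⟩
  have hx : x = ∑ i, x i • e i := by
    simpa [e] using pi_eq_sum_univ' x
  conv_lhs => rw [hx]
  simp [Omega, Fin.sum_univ_four]
  ring

/-- For `ω₀ = Ω(A·,·)` primitive, `(β ∘ A) ∧ Ω = -β ∧ ω₀`. -/
theorem wedge12_comp_Omega {ω₀ : V → V → ℝ} (halt : ∀ x y, ω₀ x y = -ω₀ y x)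
    (hprim : ∀ x y z w, wedge22 ω₀ Omega x y z w = 0) {A : V → V}
    (hA : ∀ x y, ω₀ x y = Omega (A x) y) (β : V →ₗ[ℝ] ℝ) (x y z : V) :
    wedge12 (fun v => β (A v)) Omega x y z = -wedge12 β ω₀ x y z := by
  obtain ⟨v, hv⟩ := exists_Omega_eq β
  have hβA (u : V) : β (A u) = ω₀ v u := by
    rw [hv, halt, hA]
    simp only [Omega]
    ring
  have h := hprim v x y z
  simp only [wedge22] at h
  simp only [wedge12, hβA, hv]
  linear_combination h

theorem differentiable_of_Omega {ω₀ : V → V → V → ℝ}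
    (hω₀ : ∀ x y, Differentiable ℝ fun p => ω₀ p x y) {A : V → V → V}
    (hA : ∀ p x y, ω₀ p x y = Omega (A p x) y) (x : V) :
    Differentiable ℝ fun p => A p x := by
  rw [differentiable_pi]
  have h (j : Fin 4) := hω₀ x (e j)
  simp only [hA] at h
  have h0 := h 0
  have h1 := h 1
  have h2 := h 2
  have h3 := h 3
  simp [Omega, e] at h0 h1 h2 h3
  intro i
  fin_cases i
  exacts [h2, h3, h0, h1]

/-- the identity `d((df∘(B²+Id)) ∧ Ω) = d(df∘B) ∧ ω`; in particular the
mixed form `𝕁df = df∘B + (df∘(B²+Id)) ∧ Ω` is closed iff `d(df∘B) = 0`. -/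
theorem pluriharmonic_identity (ω₀ : V → V → V → ℝ)
    (halt : ∀ p, IsAlt2 (ω₀ p)) (hsm : Smooth2 ω₀)
    (hprim : ∀ p x y z w : V, wedge22 (ω₀ p) Omega x y z w = 0)
    (lam : V → ℝ) (hlam : ContDiff ℝ (⊤ : ℕ∞) lam)
    (A₀ : V → (V →ₗ[ℝ] V)) (hA : ∀ p X Y, ω₀ p X Y = Omega (A₀ p X) Y)
    (B : V → (V →ₗ[ℝ] V)) (hB : ∀ p v, B p v = lam p • v - A₀ p v)
    (ω : V → V → V → ℝ) (hω : ∀ p x y, ω p x y = ω₀ p x y + lam p * Omega x y)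
    (hclosed : ∀ p x y z, d2 ω p x y z = 0)
    (f : V → ℝ) (hf : ContDiff ℝ (⊤ : ℕ∞) f) :
    (∀ p x y z w : V,
        d3 (fun q => wedge12 (fun v => fderiv ℝ f q (B q (B q v) + v)) Omega) p x y z w
          = wedge22 (d1 (fun q v => fderiv ℝ f q (B q v)) p) (ω p) x y z w)
    ∧ (((∀ p x y : V, d1 (fun q v => fderiv ℝ f q (B q v)) p x y = 0) ∧
        (∀ p x y z w : V,
          d3 (fun q => wedge12 (fun v => fderiv ℝ f q (B q (B q v) + v)) Omega) p x y z w
            = 0))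
      ↔ ∀ p x y : V, d1 (fun q v => fderiv ℝ f q (B q v)) p x y = 0) := by
  have hfd : Differentiable ℝ (fderiv ℝ f) :=
    (hf.fderiv_right (m := 1) (by norm_cast)).differentiable (by norm_num)
  have hω₀d (x y : V) : Differentiable ℝ fun p => ω₀ p x y :=
    (hsm x y).differentiable (by simp)
  have hlamd : Differentiable ℝ lam := hlam.differentiable (by simp)
  have hωd (x y : V) : Differentiable ℝ fun p => ω p x y := by
    simp only [hω]
    exact (hω₀d x y).add (hlamd.mul_const _)
  have hβd (v : V) : Differentiable ℝ fun q => fderiv ℝ f q (B q v) := by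
    have hAd := differentiable_of_Omega (A := fun p => A₀ p) hω₀d hA v
    simp only [hB]
    exact hfd.clm_apply ((hlamd.smul_const v).sub hAd)
  have hsplit (q x y z : V) :
      wedge12 (fun v => fderiv ℝ f q (B q (B q v) + v)) Omega x y z
        = wedge12 (fun v => fderiv ℝ f q (B q v)) (ω q) x y z
          + wedge12 (fun v => fderiv ℝ f q v) Omega x y z := by
    have h := wedge12_comp_Omega (halt q).antisymm (hprim q) (hA q)
      ((fderiv ℝ f q).toLinearMap ∘ₗ B q) x y z
    have hBB (v : V) : fderiv ℝ f q (B q (B q v) + v)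
        = lam q * fderiv ℝ f q (B q v) - fderiv ℝ f q (B q (A₀ q v)) + fderiv ℝ f q v := by
      have hv : B q (B q v) = lam q • B q v - B q (A₀ q v) := by
        rw [hB q v, map_sub, map_smul, ← hB q v]
      rw [hv]
      simp
    simp only [wedge12, LinearMap.comp_apply, ContinuousLinearMap.coe_coe] at h
    simp only [wedge12, hBB, hω]
    linear_combination -h
  have hmain (p x y z w : V) :
      d3 (fun q => wedge12 (fun v => fderiv ℝ f q (B q (B q v) + v)) Omega) p x y z w
        = wedge22 (d1 (fun q v => fderiv ℝ f q (B q v)) p) (ω p) x y z w := by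
    have hd (x y z : V) : Differentiable ℝ
        fun q => wedge12 (fun v => fderiv ℝ f q (B q v)) (ω q) x y z :=
      (((hβd x).mul (hωd y z)).sub ((hβd y).mul (hωd x z))).add ((hβd z).mul (hωd x y))
    have hdf (v : V) : Differentiable ℝ fun q => fderiv ℝ f q v :=
      hfd.clm_apply (differentiable_const v)
    have hd' (x y z : V) : Differentiable ℝ
        fun q => wedge12 (fun v => fderiv ℝ f q v) Omega x y z :=
      (((hdf x).mul_const _).sub ((hdf y).mul_const _)).add ((hdf z).mul_const _)
    have hadd (x y z w : V) :
        fderiv ℝ (fun q => wedge12 (fun v => fderiv ℝ f q (B q (B q v) + v)) Omega x y z) p w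
          = fderiv ℝ (fun q => wedge12 (fun v => fderiv ℝ f q (B q v)) (ω q) x y z) p w
            + fderiv ℝ (fun q => wedge12 (fun v => fderiv ℝ f q v) Omega x y z) p w := by
      simp only [hsplit]
      rw [fderiv_fun_add (hd x y z p) (hd' x y z p)]
      rfl
    have h₁ := d3_wedge12 (ω := ω) hβd hωd p x y z w
    have h₂ := d3_wedge12 (ω := fun _ => Omega) hdf (fun _ _ => differentiable_const _) p x y z w
    have hf₂ : ContDiff ℝ 2 f := hf.of_le (by norm_cast)
    simp only [wedge13, hclosed] at h₁
    simp only [wedge13, wedge22, d1_fderiv hf₂, d2, fderiv_fun_const] at h₂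
    simp only [d3] at h₁ h₂ ⊢
    simp only [hadd]
    simp at h₁ h₂
    linear_combination h₁ + h₂
  refine ⟨hmain, fun h => h.1, fun h => ⟨h, fun p x y z w => ?_⟩⟩
  rw [hmain]
  simp [wedge22, h]


end
end

section
/- Let ω₀ = (1−p₁²)dq₁∧dp₂ + p₁p₂(dq₁∧dp₁ − dq₂∧dp₂) + (1+p₂²)dq₂∧dp₁ be the primitive 2-form of the Born-Infeld equation (1−f_t²)f_{xx} + 2f_t f_x f_{tx} − (1+f_x²)f_{tt} = 0 on ℝ⁴. Then dω₀ = 3(p₁dp₂ − p₂dp₁)∧Ω, and consequently there exists no smooth function μ on ℝ⁴ with d(ω₀ + μΩ) = 0: the Born-Infeld equation is not of divergent type. -/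
noncomputable section

/-- The primitive 2-form of the Born-Infeld equation, with `p₁ = p 2`, `p₂ = p 3`:
`ω₀ = (1-p₁²) dq₁∧dp₂ + p₁p₂ (dq₁∧dp₁ - dq₂∧dp₂) + (1+p₂²) dq₂∧dp₁`. -/
def omegaBI : V → V → V → ℝ := fun p x y =>
  (1 - (p 2) ^ 2) * (x 0 * y 3 - x 3 * y 0)
    + p 2 * p 3 * ((x 0 * y 2 - x 2 * y 0) - (x 1 * y 3 - x 3 * y 1))
    + (1 + (p 3) ^ 2) * (x 1 * y 2 - x 2 * y 1)

/-- The coefficients of `omegaBI` are differentiable, with explicit directional derivatives. -/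
lemma hasFDerivAt_omegaBI (p x y : V) :
    ∃ L : V →L[ℝ] ℝ, HasFDerivAt (fun q => omegaBI q x y) L p ∧ ∀ v, L v =
      -(2 * p 2 * v 2) * (x 0 * y 3 - x 3 * y 0)
        + (p 2 * v 3 + p 3 * v 2) * ((x 0 * y 2 - x 2 * y 0) - (x 1 * y 3 - x 3 * y 1))
        + 2 * p 3 * v 3 * (x 1 * y 2 - x 2 * y 1) := by
  have h2 : HasFDerivAt (fun q : V => q 2) (ContinuousLinearMap.proj (R := ℝ) 2) p :=
    hasFDerivAt_apply 2 p
  have h3 : HasFDerivAt (fun q : V => q 3) (ContinuousLinearMap.proj (R := ℝ) 3) p :=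
    hasFDerivAt_apply 3 p
  refine ⟨_, ((((h2.pow 2).const_sub 1).mul_const _).add ((h2.mul h3).mul_const _)).add
    (((h3.pow 2).const_add 1).mul_const _), fun v => ?_⟩
  simp
  ring

lemma d2_omegaBI (p x y z : V) :
    d2 omegaBI p x y z = 3 * wedge12 (fun v => p 2 * v 3 - p 3 * v 2) Omega x y z := by
  obtain ⟨L₁, h₁, e₁⟩ := hasFDerivAt_omegaBI p y z
  obtain ⟨L₂, h₂, e₂⟩ := hasFDerivAt_omegaBI p x z
  obtain ⟨L₃, h₃, e₃⟩ := hasFDerivAt_omegaBI p x y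
  simp only [d2, h₁.fderiv, h₂.fderiv, h₃.fderiv, e₁, e₂, e₃, wedge12, Omega]
  ring

lemma d2_omegaBI_add_mul_Omega {μ : V → ℝ} (hμ : Differentiable ℝ μ) (p x y z : V) :
    d2 (fun q u v => omegaBI q u v + μ q * Omega u v) p x y z
      = d2 omegaBI p x y z + wedge12 (d0 μ p) Omega x y z := by
  have key (u v : V) : fderiv ℝ (fun q => omegaBI q u v + μ q * Omega u v) p
      = fderiv ℝ (fun q => omegaBI q u v) p + Omega u v • fderiv ℝ μ p := by
    obtain ⟨L, h, -⟩ := hasFDerivAt_omegaBI p u v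
    rw [h.fderiv]
    exact (h.add ((hμ p).hasFDerivAt.mul_const _)).fderiv
  simp only [d2, key, wedge12, d0, add_apply, smul_apply, smul_eq_mul]
  ring

/-- `dω₀ = 3(p₁dp₂ - p₂dp₁) ∧ Ω`, and the Born-Infeld equation is not of
divergent type: no smooth `μ` makes `ω₀ + μΩ` closed. -/
theorem bornInfeld_not_divergent :
    (∀ p x y z : V, d2 omegaBI p x y z
        = 3 * wedge12 (fun v => p 2 * v 3 - p 3 * v 2) Omega x y z)
    ∧ ¬ ∃ μ : V → ℝ, ContDiff ℝ (⊤ : ℕ∞) μ ∧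
        ∀ p x y z : V, d2 (fun q u v => omegaBI q u v + μ q * Omega u v) p x y z = 0 := by
  refine ⟨d2_omegaBI, ?_⟩
  rintro ⟨μ, hμ, hclosed⟩
  have hμ₂ : ContDiff ℝ 2 μ := contDiff_infty.1 hμ 2
  have hd : Differentiable ℝ μ := hμ.differentiable (by simp)
  have hd' : Differentiable ℝ (fderiv ℝ μ) :=
    (hμ₂.fderiv_right (m := 1) (by norm_num)).differentiable (by simp)
  have key (p x y z : V) : 3 * wedge12 (fun v => p 2 * v 3 - p 3 * v 2) Omega x y z
      + wedge12 (d0 μ p) Omega x y z = 0 := by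
    rw [← d2_omegaBI, ← d2_omegaBI_add_mul_Omega hd, hclosed]
  have h3 : (fun p => fderiv ℝ μ p (e 3)) = fun p : V => -3 * p 2 := by
    funext p
    have := key p (e 0) (e 2) (e 3)
    simp [wedge12, Omega, e, d0] at this
    simp only [e]
    linarith
  have h2 : (fun p => fderiv ℝ μ p (e 2)) = fun p : V => 3 * p 3 := by
    funext p
    have := key p (e 1) (e 2) (e 3)
    simp [wedge12, Omega, e, d0] at this
    simp only [e]
    linarith
  have hsymm : fderiv ℝ (fderiv ℝ μ) 0 (e 2) (e 3) = fderiv ℝ (fderiv ℝ μ) 0 (e 3) (e 2) :=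
    hμ₂.contDiffAt.isSymmSndFDerivAt (by simp) _ _
  have hsnd (u v : V) :
      fderiv ℝ (fderiv ℝ μ) 0 u v = fderiv ℝ (fun p => fderiv ℝ μ p v) 0 u := by
    rw [fderiv_clm_apply (hd' 0) (differentiableAt_const v)]
    simp
  have hcoord (c : ℝ) (i : Fin 4) (u : V) :
      fderiv ℝ (fun p : V => c * p i) 0 u = c * u i := by
    rw [((hasFDerivAt_apply (𝕜 := ℝ) i (0 : V)).const_mul c).fderiv]
    simp
  rw [hsnd, hsnd, h3, h2, hcoord, hcoord] at hsymm
  simp [e] at hsymm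
  norm_num at hsymm

end
end

section
/- Fix real constants α, β and a smooth function γ of (q₁,q₂), and let ω₀ = (αp₁ + βp₂ + γ(q₁,q₂))dq₁∧dq₂ + dq₁∧dp₂ − q₂·dq₂∧dp₁ be the 2-form of the Tricomi equation. Then dω₀ = (−α dq₂ + β dq₁)∧Ω, and the smooth function μ = αq₂ − βq₁ satisfies d(ω₀ + μΩ) = 0: the Tricomi equation is of divergent type. -/
noncomputable section

/-- The 2-form of the Tricomi equation, with `q₁ = p 0`, `q₂ = p 1`, `p₁ = p 2`,
`p₂ = p 3`: `ω₀ = (αp₁ + βp₂ + γ(q₁,q₂)) dq₁∧dq₂ + dq₁∧dp₂ - q₂ dq₂∧dp₁`. -/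
def omegaTricomi (a b : ℝ) (γ : ℝ → ℝ → ℝ) : V → V → V → ℝ := fun p x y =>
  (a * p 2 + b * p 3 + γ (p 0) (p 1)) * (x 0 * y 1 - x 1 * y 0)
    + (x 0 * y 3 - x 3 * y 0) - p 1 * (x 1 * y 2 - x 2 * y 1)

/-- The derivative of a component of `ω₀ + (s q₂ + t q₁) Ω` along a constant vector. -/
theorem fderiv_omegaTricomi_add (a b s t : ℝ) (γ : ℝ → ℝ → ℝ)
    (hγ : Differentiable ℝ fun q : ℝ × ℝ => γ q.1 q.2) (p u v w : V) :
    fderiv ℝ (fun q : V => omegaTricomi a b γ q u v + (s * q 1 - t * q 0) * Omega u v) p w =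
      (a * w 2 + b * w 3
          + (w 0 * fderiv ℝ (fun q : ℝ × ℝ => γ q.1 q.2) (p 0, p 1) (1, 0)
            + w 1 * fderiv ℝ (fun q : ℝ × ℝ => γ q.1 q.2) (p 0, p 1) (0, 1)))
          * (u 0 * v 1 - u 1 * v 0)
        - w 1 * (u 1 * v 2 - u 2 * v 1) + (s * w 1 - t * w 0) * Omega u v := by
  have hproj (i : Fin 4) : HasFDerivAt (fun q : V => q i)
      (ContinuousLinearMap.proj (R := ℝ) (φ := fun _ : Fin 4 => ℝ) i) p := hasFDerivAt_apply i p
  have hcomp := HasFDerivAt.comp (f := fun q : V => (q 0, q 1)) p (hγ (p 0, p 1)).hasFDerivAt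
    ((hproj 0).prodMk (hproj 1))
  have hsplit : fderiv ℝ (fun q : ℝ × ℝ => γ q.1 q.2) (p 0, p 1) (w 0, w 1) =
      w 0 * fderiv ℝ (fun q : ℝ × ℝ => γ q.1 q.2) (p 0, p 1) (1, 0)
        + w 1 * fderiv ℝ (fun q : ℝ × ℝ => γ q.1 q.2) (p 0, p 1) (0, 1) := by
    rw [← smul_eq_mul, ← smul_eq_mul, ← map_smul, ← map_smul, ← map_add]
    simp
  have hmain := (((((((hproj 2).const_mul a).add ((hproj 3).const_mul b)).add hcomp).mul_const
    (u 0 * v 1 - u 1 * v 0)).add_const (u 0 * v 3 - u 3 * v 0)).sub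
      ((hproj 1).mul_const (u 1 * v 2 - u 2 * v 1))).add
      ((((hproj 1).const_mul s).sub ((hproj 0).const_mul t)).mul_const (Omega u v))
  rw [← hsplit]
  refine (DFunLike.congr_fun hmain.fderiv w).trans ?_
  simp
  ring

/-- `dω₀ = (-α dq₂ + β dq₁) ∧ Ω`, and `μ = αq₂ - βq₁` makes `ω₀ + μΩ`
closed: the Tricomi equation is of divergent type. -/
theorem tricomi_divergent (a b : ℝ) (γ : ℝ → ℝ → ℝ)
    (hγ : ContDiff ℝ (⊤ : ℕ∞) fun q : ℝ × ℝ => γ q.1 q.2) :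
    (∀ p x y z : V, d2 (omegaTricomi a b γ) p x y z
        = wedge12 (fun v => -a * v 1 + b * v 0) Omega x y z)
    ∧ ∀ p x y z : V,
        d2 (fun q u v => omegaTricomi a b γ q u v + (a * q 1 - b * q 0) * Omega u v)
          p x y z = 0 := by
  have hd : Differentiable ℝ fun q : ℝ × ℝ => γ q.1 q.2 := hγ.differentiable (by simp)
  constructor
  · intro p x y z
    have h := fderiv_omegaTricomi_add a b 0 0 γ hd p
    simp only [zero_mul, sub_zero, add_zero] at h
    simp only [d2, h, wedge12, Omega]
    ring
  · intro p x y z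
    simp only [d2, fderiv_omegaTricomi_add a b a b γ hd p]
    simp only [Omega]
    ring

end
end

section
/- Let ω₀ be a smooth differential 2-form on ℝ⁴ that is pointwise primitive and whose pfaffian pf(ω₀) is nowhere zero, let A₀ be the field of endomorphisms defined by ω₀(X,Y) = Ω(A₀X,Y), and set J₀ = A₀/√|pf(ω₀)|. Then the Nijenhuis tensor of J₀ vanishes identically (J₀ is an integrable almost complex or almost product structure) if and only if the 2-form ω₀/√|pf(ω₀)| is closed. -/
noncomputable section

lemma Omega_left_nondegenerate {x : V} (h : ∀ y, Omega x y = 0) : x = 0 := by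
  funext i
  have h0 := h (e 0)
  have h1 := h (e 1)
  have h2 := h (e 2)
  have h3 := h (e 3)
  simp [Omega, e] at h0 h1 h2 h3
  fin_cases i <;> assumption

lemma vec_eq_sum_basis (x : V) : x = x 0 • e 0 + x 1 • e 1 + x 2 • e 2 + x 3 • e 3 := by
  funext i
  fin_cases i <;> simp [e]

/-- An endomorphism representing a 2-form through `Ω` is `Ω`-self-adjoint. -/
lemma Omega_selfAdjoint {ω : V → V → ℝ} (halt : IsAlt2 ω) {A : V →ₗ[ℝ] V}
    (hA : ∀ x y, ω x y = Omega (A x) y) (x y : V) : Omega (A x) y = Omega x (A y) := by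
  rw [← hA, halt.antisymm, hA]
  simp only [Omega]
  ring

lemma pfaffian_eq {ω : V → V → ℝ} {c : ℝ}
    (hpf : ∀ x y z w, wedge22 ω ω x y z w = c * wedge22 Omega Omega x y z w) :
    c = -(ω (e 0) (e 1) * ω (e 2) (e 3) - ω (e 0) (e 2) * ω (e 1) (e 3)
      + ω (e 0) (e 3) * ω (e 1) (e 2)) := by
  have h := hpf (e 0) (e 1) (e 2) (e 3)
  simp [wedge22, Omega, e] at h ⊢
  linarith

/-- The endomorphism representing a primitive 2-form squares to minus its pfaffian. -/
lemma primitive_sq {ω : V → V → ℝ} (halt : IsAlt2 ω)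
    (hprim : ∀ x y z w, wedge22 ω Omega x y z w = 0) {c : ℝ}
    (hpf : ∀ x y z w, wedge22 ω ω x y z w = c * wedge22 Omega Omega x y z w)
    {A : V →ₗ[ℝ] V} (hA : ∀ x y, ω x y = Omega (A x) y) (x : V) :
    A (A x) = (-c) • x := by
  have hc := pfaffian_eq hpf
  have hp : ω (e 1) (e 3) = -ω (e 0) (e 2) := by
    have h := hprim (e 0) (e 1) (e 2) (e 3)
    simp [wedge22, Omega, e] at h ⊢
    linarith
  have hself : ∀ y, ω y y = 0 := fun y => by linarith [halt.antisymm y y]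
  have a0 : ∀ y, A y 0 = ω y (e 2) := fun y => by simp [hA, Omega, e]
  have a1 : ∀ y, A y 1 = ω y (e 3) := fun y => by simp [hA, Omega, e]
  have a2 : ∀ y, A y 2 = -ω y (e 0) := fun y => by simp [hA, Omega, e]
  have a3 : ∀ y, A y 3 = -ω y (e 1) := fun y => by simp [hA, Omega, e]
  have hexp : ∀ y z, ω y z = y 0 * ω (e 0) z + y 1 * ω (e 1) z + y 2 * ω (e 2) z
      + y 3 * ω (e 3) z := fun y z => by
    conv_lhs => rw [vec_eq_sum_basis y]
    simp only [halt.add_left, halt.smul_left]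
  have key : ∀ y z, ω (A y) z = ω y (e 2) * ω (e 0) z + ω y (e 3) * ω (e 1) z
      - ω y (e 0) * ω (e 2) z - ω y (e 1) * ω (e 3) z := fun y z => by
    rw [hexp (A y), a0, a1, a2, a3]
    ring
  have s10 := halt.antisymm (e 1) (e 0)
  have s20 := halt.antisymm (e 2) (e 0)
  have s30 := halt.antisymm (e 3) (e 0)
  have s21 := halt.antisymm (e 2) (e 1)
  have s31 := halt.antisymm (e 3) (e 1)
  have s32 := halt.antisymm (e 3) (e 2)
  funext i
  fin_cases i <;>
    simp only [Fin.zero_eta, Fin.mk_one, Fin.reduceFinMk, a0, a1, a2, a3, key, Pi.smul_apply,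
      smul_eq_mul, hexp x, hself, s10, s20, s30, s21, s31, s32, hp, hc] <;>
    ring

/-- The exterior derivative of the 2-form `Ω(K·,·)`, in terms of the derivative `T` of `K`. -/
def dForm (T : V →L[ℝ] V →L[ℝ] V) (x y z : V) : ℝ :=
  Omega (T x y) z - Omega (T y x) z + Omega (T z x) y

/-- The Nijenhuis tensor of `K`, in terms of the derivative `T` of `K`. -/
def nijenhuisTensor (K : V →L[ℝ] V) (T : V →L[ℝ] V →L[ℝ] V) (x y : V) : V :=
  T (K x) y - T (K y) x + K (T y x) - K (T x y)

lemma Omega_nijenhuisTensor {K : V →L[ℝ] V} {T : V →L[ℝ] V →L[ℝ] V}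
    (hK : ∀ x y, Omega (K x) y = Omega x (K y))
    (hT : ∀ v x y, Omega (T v x) y = Omega x (T v y))
    (hTK : ∀ v x, T v (K x) = -K (T v x)) (x y z : V) :
    Omega (nijenhuisTensor K T x y) z = dForm T (K x) y z + dForm T x (K y) z := by
  have h := hT z (K x) y
  rw [hK, ← neg_eq_iff_eq_neg.mpr (hTK z y)] at h
  have h' := hT z x (K y)
  simp only [dForm, nijenhuisTensor, hTK y x, hTK x y]
  simp only [Omega, Pi.add_apply, Pi.sub_apply, Pi.neg_apply] at h h' ⊢
  linarith

lemma nijenhuisTensor_eq_zero_iff {K : V →L[ℝ] V} {T : V →L[ℝ] V →L[ℝ] V}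
    (hK : ∀ x y, Omega (K x) y = Omega x (K y))
    (hT : ∀ v x y, Omega (T v x) y = Omega x (T v y))
    (hTK : ∀ v x, T v (K x) = -K (T v x)) {c : ℝ} (hc : c ≠ 0)
    (hKK : ∀ x, K (K x) = c • x) :
    (∀ x y, nijenhuisTensor K T x y = 0) ↔ ∀ x y z, dForm T x y z = 0 := by
  have key := Omega_nijenhuisTensor hK hT hTK
  constructor
  · intro h
    have hswap : ∀ x y z, dForm T x y z = -dForm T y x z := fun x y z => by
      have := hT z x y
      simp only [dForm, Omega] at this ⊢
      linarith
    have hswap' : ∀ x y z, dForm T x y z = -dForm T x z y := fun x y z => by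
      have := hT x y z
      simp only [dForm, Omega] at this ⊢
      linarith
    have hmove : ∀ x y z, dForm T (K x) y z = -dForm T x (K y) z := fun x y z => by
      have := key x y z
      rw [h] at this
      simp only [Omega, Pi.zero_apply] at this
      linarith
    have hzero : ∀ x y z, dForm T (K x) y z = 0 := fun x y z => by
      linarith [hmove x y z, hmove x z y, hmove y z x, hswap' (K x) y z, hswap' x (K z) y,
        hswap x (K y) z, hswap' (K y) x z, hswap' y (K z) x, hswap y x (K z)]
    intro x y z
    have hx : x = K (c⁻¹ • K x) := by
      rw [map_smul, hKK, smul_smul, inv_mul_cancel₀ hc, one_smul]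
    rw [hx]
    exact hzero _ _ _
  · intro h x y
    refine Omega_left_nondegenerate fun z => ?_
    rw [key, h, h, add_zero]

section Derivatives

variable {K : V → (V →L[ℝ] V)} {T : V →L[ℝ] V →L[ℝ] V} {p : V}

lemma fderiv_Omega_apply (hK : HasFDerivAt K T p) (x y v : V) :
    fderiv ℝ (fun q => Omega (K q x) y) p v = Omega (T v x) y := by
  have h : HasFDerivAt (fun q => K q x) (T.flip x) p := by
    simpa using hK.clm_apply (hasFDerivAt_const x p)
  have hi := fun i => hasFDerivAt_pi'.1 h i
  have hd := ((((hi 0).mul_const (y 2)).sub ((hi 2).mul_const (y 0))).add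
    ((hi 1).mul_const (y 3))).sub ((hi 3).mul_const (y 1))
  have he : fderiv ℝ (fun q => Omega (K q x) y) p = _ := hd.fderiv
  rw [he]
  simp [Omega]
  ring

lemma nijenhuis_eq_nijenhuisTensor {J : V → (V →ₗ[ℝ] V)} (hJK : ∀ q x, J q x = K q x)
    (hK : HasFDerivAt K T p) {X Y : V → V} (hX : DifferentiableAt ℝ X p)
    (hY : DifferentiableAt ℝ Y p) :
    nijenhuis J X Y p = nijenhuisTensor (K p) T (X p) (Y p) := by
  have hKX := (hK.clm_apply hX.hasFDerivAt).fderiv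
  have hKY := (hK.clm_apply hY.hasFDerivAt).fderiv
  simp only [nijenhuis, lieBracket, nijenhuisTensor, hJK, hKX, hKY]
  simp only [add_apply, ContinuousLinearMap.comp_apply,
    ContinuousLinearMap.flip_apply, map_sub, map_add]
  abel

lemma fderiv_anticommutes (hK : HasFDerivAt K T p) {c : ℝ}
    (hsq : ∀ᶠ q in nhds p, ∀ x, K q (K q x) = c • x) (v x : V) :
    T v (K p x) = -K p (T v x) := by
  have h : HasFDerivAt (fun q => K q x) (T.flip x) p := by
    simpa using hK.clm_apply (hasFDerivAt_const x p)
  have h1 := hK.clm_apply h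
  have h2 : HasFDerivAt (fun q => K q (K q x)) (0 : V →L[ℝ] V) p :=
    (hasFDerivAt_const (c • x) p).congr_of_eventuallyEq (hsq.mono fun q hq => hq x)
  have h3 := DFunLike.congr_fun (h1.unique h2) v
  simp only [add_apply, ContinuousLinearMap.comp_apply,
    ContinuousLinearMap.flip_apply, zero_apply] at h3
  exact eq_neg_of_add_eq_zero_right h3

lemma fderiv_Omega_selfAdjoint (hK : HasFDerivAt K T p)
    (hself : ∀ q x y, Omega (K q x) y = Omega x (K q y)) (v x y : V) :
    Omega (T v x) y = Omega x (T v y) := by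
  have hneg : ∀ a b, Omega a b = -Omega b a := fun a b => by
    simp only [Omega]
    ring
  have h : (fun q => Omega (K q x) y) = fun q => -Omega (K q y) x :=
    funext fun q => by rw [hself, hneg]
  rw [← fderiv_Omega_apply hK, h, fderiv_fun_neg, neg_apply,
    fderiv_Omega_apply hK, ← hneg]

end Derivatives

/-- Lychagin–Roubtsov: for `ω₀` pointwise primitive with nowhere
vanishing pfaffian and `J₀ = A₀/√|pf(ω₀)|`, the Nijenhuis tensor of `J₀` vanishes
identically iff the 2-form `ω₀/√|pf(ω₀)|` is closed. -/
theorem lychagin_roubtsov_integrability (ω₀ : V → V → V → ℝ)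
    (halt : ∀ p, IsAlt2 (ω₀ p)) (hsm : Smooth2 ω₀)
    (hprim : ∀ p x y z w : V, wedge22 (ω₀ p) Omega x y z w = 0)
    (pf : V → ℝ)
    (hpf : ∀ p x y z w : V,
      wedge22 (ω₀ p) (ω₀ p) x y z w = pf p * wedge22 Omega Omega x y z w)
    (hpf0 : ∀ p, pf p ≠ 0)
    (A₀ : V → (V →ₗ[ℝ] V)) (hA : ∀ p X Y, ω₀ p X Y = Omega (A₀ p X) Y)
    (hAsm : ∀ v, ContDiff ℝ (⊤ : ℕ∞) fun p => A₀ p v)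
    (J₀ : V → (V →ₗ[ℝ] V)) (hJ : ∀ p, J₀ p = (Real.sqrt |pf p|)⁻¹ • A₀ p) :
    (∀ X Y : V → V, ContDiff ℝ (⊤ : ℕ∞) X → ContDiff ℝ (⊤ : ℕ∞) Y →
        ∀ p, nijenhuis J₀ X Y p = 0)
      ↔ ∀ p x y z : V,
          d2 (fun q u v => (Real.sqrt |pf q|)⁻¹ * ω₀ q u v) p x y z = 0 := by
  have hpf_smooth : ContDiff ℝ 1 pf := by
    have hω : ∀ x y, ContDiff ℝ 1 fun q => ω₀ q x y := fun x y =>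
      (hsm x y).of_le (by exact_mod_cast le_top)
    rw [show pf = _ from funext fun q => pfaffian_eq (hpf q)]
    exact ((((hω _ _).mul (hω _ _)).sub ((hω _ _).mul (hω _ _))).add
      ((hω _ _).mul (hω _ _))).neg
  have hsqrt : ∀ q, Real.sqrt |pf q| ≠ 0 := fun q =>
    (Real.sqrt_pos.2 (abs_pos.2 (hpf0 q))).ne'
  let K : V → (V →L[ℝ] V) := fun q => LinearMap.toContinuousLinearMap (J₀ q)
  have hJK : ∀ q x, J₀ q x = K q x := fun q x => rfl
  have hK_smooth : ContDiff ℝ 1 K := by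
    rw [contDiff_clm_apply_iff]
    intro x
    have hs : ContDiff ℝ 1 fun q => (Real.sqrt |pf q|)⁻¹ :=
      contDiff_iff_contDiffAt.2 fun q =>
        ((hpf_smooth.contDiffAt.abs (hpf0 q)).sqrt (abs_ne_zero.2 (hpf0 q))).inv (hsqrt q)
    have he : (fun q => K q x) = fun q => (Real.sqrt |pf q|)⁻¹ • A₀ q x :=
      funext fun q => by rw [← hJK, hJ, LinearMap.smul_apply]
    rw [he]
    exact hs.smul ((hAsm x).of_le (by exact_mod_cast le_top))
  have hK : ∀ p, HasFDerivAt K (fderiv ℝ K p) p := fun p =>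
    (hK_smooth.differentiable one_ne_zero p).hasFDerivAt
  have hform : ∀ q x y, (Real.sqrt |pf q|)⁻¹ * ω₀ q x y = Omega (K q x) y := fun q x y => by
    rw [← hJK, hJ, hA]
    simp only [Omega, LinearMap.smul_apply, Pi.smul_apply, smul_eq_mul]
    ring
  have hself : ∀ q x y, Omega (K q x) y = Omega x (K q y) := fun q x y => by
    have h := Omega_selfAdjoint (halt q) (hA q) x y
    rw [← hform, hA, h, ← hJK, hJ]
    simp only [Omega, LinearMap.smul_apply, Pi.smul_apply, smul_eq_mul]
    ring
  have hsq : ∀ q x, K q (K q x) = (-(pf q / |pf q|)) • x := fun q x => by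
    rw [← hJK, ← hJK, hJ, LinearMap.smul_apply, LinearMap.smul_apply, map_smul,
      primitive_sq (halt q) (hprim q) (hpf q) (hA q), smul_smul, smul_smul, ← mul_inv,
      Real.mul_self_sqrt (abs_nonneg _)]
    congr 1
    ring
  have hsign : ∀ p, ∀ᶠ q in nhds p, pf q / |pf q| = pf p / |pf p| := fun p => by
    have hc := hpf_smooth.continuous.continuousAt (x := p)
    rcases lt_or_gt_of_ne (hpf0 p) with h | h
    · filter_upwards [hc.eventually_lt_const h] with q hq
      rw [abs_of_neg hq, abs_of_neg h, div_neg, div_neg, div_self hq.ne, div_self h.ne]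
    · filter_upwards [hc.eventually_const_lt h] with q hq
      rw [abs_of_pos hq, abs_of_pos h, div_self hq.ne', div_self h.ne']
  have key : ∀ p, (∀ x y, nijenhuisTensor (K p) (fderiv ℝ K p) x y = 0) ↔
      ∀ x y z, dForm (fderiv ℝ K p) x y z = 0 := fun p =>
    nijenhuisTensor_eq_zero_iff (hself p) (fderiv_Omega_selfAdjoint (hK p) hself)
      (fderiv_anticommutes (hK p) ((hsign p).mono fun q hq x => by rw [hsq, hq]))
      (neg_ne_zero.2 (div_ne_zero (hpf0 p) (abs_ne_zero.2 (hpf0 p)))) (hsq p)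
  have hd2 : ∀ p x y z, d2 (fun q u v => (Real.sqrt |pf q|)⁻¹ * ω₀ q u v) p x y z =
      dForm (fderiv ℝ K p) x y z := fun p x y z => by
    simp only [d2, dForm, hform, fderiv_Omega_apply (hK p)]
  simp only [hd2]
  constructor
  · intro h p
    refine (key p).1 fun x y => ?_
    rw [← h (fun _ => x) (fun _ => y) contDiff_const contDiff_const p]
    exact (nijenhuis_eq_nijenhuisTensor hJK (hK p) (differentiableAt_const x)
      (differentiableAt_const y)).symm
  · intro h X Y hX hY p
    rw [nijenhuis_eq_nijenhuisTensor hJK (hK p) (hX.differentiable (by simp) p)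
      (hY.differentiable (by simp) p)]
    exact (key p).2 (h p) _ _

end
end
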